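/- For every ξ > 0 and every nonzero x in R^3, the Hasimoto splitting function Φ_H(r, ξ) = r erf(ξ r) + e^{-ξ^2 r^2}/(√π ξ), evaluated at r = |x|, satisfies the biharmonic relation Δ^2 [Φ_H(|x|, ξ)] = −8π · ξ^3 π^{-3/2} e^{-ξ^2 |x|^2} (5/2 − ξ^2 |x|^2), where Δ^2 is the bi-Laplacian (Laplacian applied twice) on R^3. -/

import Mathlib

open MeasureTheory Real Filter

noncomputable section

/-- Euclidean 3-space. -/
abbrev E3 := EuclideanSpace ℝ (Fin 3)

/-- Partial derivative in the `j`-th coordinate direction. -/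
def pd (j : Fin 3) (f : E3 → ℝ) (x : E3) : ℝ :=
  fderiv ℝ f x (EuclideanSpace.single j 1)

/-- Laplacian on `E3`. -/
def lap (f : E3 → ℝ) (x : E3) : ℝ :=
  ∑ i : Fin 3, pd i (pd i f) x

/-- Gauss error function. -/
def erf (t : ℝ) : ℝ := (2 / Real.sqrt π) * ∫ s in (0:ℝ)..t, Real.exp (-s ^ 2)

/-- Complementary error function. -/
def erfc (t : ℝ) : ℝ := 1 - erf t

/-- Kronecker delta on `Fin 3`. -/
def kron (j l : Fin 3) : ℝ := if j = l then 1 else 0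

/-- Levi-Civita symbol on `Fin 3`. -/
def lev (j l m : Fin 3) : ℝ :=
  ((l.val : ℝ) - (j.val : ℝ)) * ((m.val : ℝ) - (l.val : ℝ)) * ((m.val : ℝ) - (j.val : ℝ)) / 2

theorem pd_congr {j : Fin 3} {f g : E3 → ℝ} {x : E3} (h : f =ᶠ[nhds x] g) :
    pd j f x = pd j g x := by
  unfold pd
  rw [h.fderiv_eq]

theorem eventually_pd_congr {j : Fin 3} {f g : E3 → ℝ} {x : E3} (h : f =ᶠ[nhds x] g) :
    pd j f =ᶠ[nhds x] pd j g :=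
  h.eventuallyEq_nhds.mono fun _ hy => pd_congr hy

theorem lap_congr {f g : E3 → ℝ} {x : E3} (h : f =ᶠ[nhds x] g) : lap f x = lap g x :=
  Finset.sum_congr rfl fun _ _ => pd_congr (eventually_pd_congr h)

theorem hasFDerivAt_norm_E3 {x : E3} (hx : x ≠ 0) :
    HasFDerivAt (fun y : E3 => ‖y‖) (‖x‖⁻¹ • innerSL ℝ x) x := by
  have h := (hasStrictFDerivAt_norm_sq x).hasFDerivAt.sqrt (by simpa using hx)
  simp only [Real.sqrt_sq (norm_nonneg _)] at h
  refine h.congr_fderiv ?_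
  ext v
  simp
  ring

/-- The partial derivatives of a radial function away from the origin. -/
theorem pd_radial {f : ℝ → ℝ} {f' : ℝ} {x : E3} (hx : x ≠ 0) (hf : HasDerivAt f f' ‖x‖)
    (j : Fin 3) : pd j (fun y => f ‖y‖) x = f' / ‖x‖ * x j := by
  have h := hf.comp_hasFDerivAt x (hasFDerivAt_norm_E3 hx)
  unfold pd
  rw [show (fun y : E3 => f ‖y‖) = f ∘ fun y => ‖y‖ from rfl, h.fderiv]
  simp [EuclideanSpace.inner_single_right]
  ring

/-- The Laplacian of a radial function away from the origin. -/
theorem lap_radial {f f' : ℝ → ℝ} {f'' : ℝ} {x : E3} (hx : x ≠ 0)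
    (hf : ∀ r, 0 < r → HasDerivAt f (f' r) r) (hf' : HasDerivAt f' f'' ‖x‖) :
    lap (fun y => f ‖y‖) x = f'' + 2 / ‖x‖ * f' ‖x‖ := by
  have hr : ‖x‖ ≠ 0 := norm_ne_zero_iff.2 hx
  have hpd (j : Fin 3) : pd j (pd j (fun y => f ‖y‖)) x
      = (f'' * ‖x‖ - f' ‖x‖) / ‖x‖ ^ 3 * x j ^ 2 + f' ‖x‖ / ‖x‖ := by
    have hev : pd j (fun y => f ‖y‖) =ᶠ[nhds x] fun y => (f' ‖y‖ / ‖y‖) * y j := by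
      filter_upwards [isOpen_ne.mem_nhds hx] with y hy
      exact pd_radial hy (hf _ (norm_pos_iff.2 hy)) j
    rw [pd_congr hev]
    have hq : HasDerivAt (fun r => f' r / r) ((f'' * ‖x‖ - f' ‖x‖ * 1) / ‖x‖ ^ 2) ‖x‖ :=
      hf'.div (hasDerivAt_id _) hr
    have h := (hq.comp_hasFDerivAt x (hasFDerivAt_norm_E3 hx)).mul
      (EuclideanSpace.proj j : E3 →L[ℝ] ℝ).hasFDerivAt
    unfold pd
    rw [HasFDerivAt.fderiv (f := fun y : E3 => (f' ‖y‖ / ‖y‖) * y j) h]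
    simp [EuclideanSpace.inner_single_right]
    field_simp
    ring
  have hn : x 0 ^ 2 + x 1 ^ 2 + x 2 ^ 2 = ‖x‖ ^ 2 := by
    simp [EuclideanSpace.norm_sq_eq, Fin.sum_univ_three]
  simp only [lap, hpd, Fin.sum_univ_three]
  calc _ = (f'' * ‖x‖ - f' ‖x‖) / ‖x‖ ^ 3 * (x 0 ^ 2 + x 1 ^ 2 + x 2 ^ 2)
        + 3 * (f' ‖x‖ / ‖x‖) := by ring
    _ = _ := by
      rw [hn]
      field_simp
      ring

theorem hasDerivAt_erf (t : ℝ) : HasDerivAt erf (2 / √π * Real.exp (-t ^ 2)) t := by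
  have hc : Continuous fun s : ℝ => Real.exp (-s ^ 2) := by fun_prop
  exact (hc.integral_hasStrictDerivAt 0 t).hasDerivAt.const_mul _

theorem hasDerivAt_erf_mul (ξ r : ℝ) :
    HasDerivAt (fun r => erf (ξ * r)) (2 * ξ / √π * Real.exp (-ξ ^ 2 * r ^ 2)) r := by
  have h := (hasDerivAt_erf (ξ * r)).comp r ((hasDerivAt_id r).const_mul ξ)
  refine h.congr_deriv ?_
  rw [show -(ξ * r) ^ 2 = -ξ ^ 2 * r ^ 2 by ring]
  ring

theorem hasDerivAt_exp_neg_sq_mul_sq (ξ r : ℝ) :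
    HasDerivAt (fun r => Real.exp (-ξ ^ 2 * r ^ 2))
      (-2 * ξ ^ 2 * r * Real.exp (-ξ ^ 2 * r ^ 2)) r := by
  have h := ((hasDerivAt_pow 2 r).const_mul (-ξ ^ 2)).exp
  refine h.congr_deriv ?_
  push_cast
  ring

theorem hasDerivAt_hasimoto_splitting (ξ r : ℝ) :
    HasDerivAt (fun r => r * erf (ξ * r) + Real.exp (-ξ ^ 2 * r ^ 2) / (√π * ξ))
      (erf (ξ * r)) r := by
  have h := ((hasDerivAt_id r).mul (hasDerivAt_erf_mul ξ r)).add
    ((hasDerivAt_exp_neg_sq_mul_sq ξ r).div_const (√π * ξ))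
  refine h.congr_deriv ?_
  have : √π ≠ 0 := by positivity
  simp only [id]
  field_simp
  ring

/-- The Laplacian of the Hasimoto splitting function away from the origin. -/
theorem lap_hasimoto_splitting (ξ : ℝ) {x : E3} (hx : x ≠ 0) :
    lap (fun y => ‖y‖ * erf (ξ * ‖y‖) + Real.exp (-ξ ^ 2 * ‖y‖ ^ 2) / (√π * ξ)) x
      = 2 * ξ / √π * Real.exp (-ξ ^ 2 * ‖x‖ ^ 2) + 2 / ‖x‖ * erf (ξ * ‖x‖) :=
  lap_radial (f := fun r => r * erf (ξ * r) + Real.exp (-ξ ^ 2 * r ^ 2) / (√π * ξ)) hx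
    (fun r _ => hasDerivAt_hasimoto_splitting ξ r) (hasDerivAt_erf_mul ξ ‖x‖)

/-- The radial derivative of the Laplacian of the Hasimoto splitting function. -/
theorem hasDerivAt_lap_hasimoto_splitting (ξ : ℝ) {r : ℝ} (hr : r ≠ 0) :
    HasDerivAt (fun r => 2 * ξ / √π * Real.exp (-ξ ^ 2 * r ^ 2) + 2 / r * erf (ξ * r))
      (2 * ξ / √π * Real.exp (-ξ ^ 2 * r ^ 2) * (2 / r - 2 * ξ ^ 2 * r)
        - 2 / r ^ 2 * erf (ξ * r)) r := by
  have h := ((hasDerivAt_exp_neg_sq_mul_sq ξ r).const_mul (2 * ξ / √π)).add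
    (((hasDerivAt_const r (2 : ℝ)).div (hasDerivAt_id r) hr).mul (hasDerivAt_erf_mul ξ r))
  refine h.congr_deriv ?_
  simp only [id, Pi.div_apply]
  field_simp
  ring

/-- The second radial derivative of the Laplacian of the Hasimoto splitting function. -/
theorem hasDerivAt_deriv_lap_hasimoto_splitting (ξ : ℝ) {r : ℝ} (hr : r ≠ 0) :
    HasDerivAt (fun r => 2 * ξ / √π * Real.exp (-ξ ^ 2 * r ^ 2) * (2 / r - 2 * ξ ^ 2 * r)
        - 2 / r ^ 2 * erf (ξ * r))
      (2 * ξ / √π * Real.exp (-ξ ^ 2 * r ^ 2)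
        * (4 * ξ ^ 4 * r ^ 2 - 6 * ξ ^ 2 - 4 / r ^ 2) + 4 / r ^ 3 * erf (ξ * r)) r := by
  have h := (((hasDerivAt_exp_neg_sq_mul_sq ξ r).const_mul (2 * ξ / √π)).mul
    (((hasDerivAt_const r (2 : ℝ)).div (hasDerivAt_id r) hr).sub
      ((hasDerivAt_id r).const_mul (2 * ξ ^ 2)))).sub
    (((hasDerivAt_const r (2 : ℝ)).div (hasDerivAt_pow 2 r) (pow_ne_zero 2 hr)).mul
      (hasDerivAt_erf_mul ξ r))
  refine h.congr_deriv ?_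
  simp only [id, Pi.div_apply, Pi.sub_apply]
  push_cast
  field_simp
  ring

/-- The Hasimoto splitting function satisfies the biharmonic relation
`Δ² Φ_H(|x|, ξ) = −8π γ_H(x, ξ)`. -/
theorem hasimoto_splitting_bilaplacian (ξ : ℝ) (hξ : 0 < ξ) (x : E3) (hx : x ≠ 0) :
    lap (lap (fun y => ‖y‖ * erf (ξ * ‖y‖)
        + Real.exp (-ξ ^ 2 * ‖y‖ ^ 2) / (Real.sqrt π * ξ))) x
      = -(8 * π) * (ξ ^ 3 * π ^ (-(3 : ℝ) / 2) * Real.exp (-ξ ^ 2 * ‖x‖ ^ 2)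
          * (5 / 2 - ξ ^ 2 * ‖x‖ ^ 2)) := by
  have hr : ‖x‖ ≠ 0 := norm_ne_zero_iff.2 hx
  have hev : lap (fun y => ‖y‖ * erf (ξ * ‖y‖) + Real.exp (-ξ ^ 2 * ‖y‖ ^ 2) / (√π * ξ))
      =ᶠ[nhds x] fun y =>
        2 * ξ / √π * Real.exp (-ξ ^ 2 * ‖y‖ ^ 2) + 2 / ‖y‖ * erf (ξ * ‖y‖) := by
    filter_upwards [isOpen_ne.mem_nhds hx] with y hy
    exact lap_hasimoto_splitting ξ hy
  rw [lap_congr hev, lap_radial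
    (f := fun r => 2 * ξ / √π * Real.exp (-ξ ^ 2 * r ^ 2) + 2 / r * erf (ξ * r)) hx
    (fun r hr => hasDerivAt_lap_hasimoto_splitting ξ hr.ne')
    (hasDerivAt_deriv_lap_hasimoto_splitting ξ hr)]
  have hpi : π ^ (-(3 : ℝ) / 2) = 1 / (π * √π) := by
    rw [show -(3 : ℝ) / 2 = -(1 + 1 / 2) by norm_num, Real.rpow_neg pi_pos.le,
      Real.rpow_add pi_pos, Real.rpow_one, ← Real.sqrt_eq_rpow, one_div]
  rw [hpi]
  have hs : √π ≠ 0 := by positivity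
  field_simp
  ring
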